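/- If G is a finite non-Abelian group, then the commuting probability c(G) is at most 5/8. -/

import Mathlib

theorem two_card_le_of_lt {G : Type*} [Group G] [Finite G] {H K : Subgroup G} (h : H < K) :
    2 * Nat.card H ≤ Nat.card K := by
  obtain ⟨c, hc⟩ := Subgroup.card_dvd_of_le h.le
  have hne : c ≠ 1 := by
    rintro rfl
    exact h.ne (Subgroup.eq_of_le_of_card_ge h.le (by omega))
  have hK : 0 < Nat.card K := Nat.card_pos
  have h0 : c ≠ 0 := by
    rintro rfl
    omega
  have h2 : 2 ≤ c := by omega
  rw [hc, mul_comm]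
  exact Nat.mul_le_mul_left _ h2

theorem centralizer_lt_top_of_not_mem {G : Type*} [Group G] {x : G}
    (hx : x ∉ Subgroup.center G) : Subgroup.centralizer {x} < ⊤ := by
  refine lt_top_iff_ne_top.2 fun h => hx ?_
  rw [Subgroup.mem_center_iff]
  intro g
  have hg : g ∈ Subgroup.centralizer {x} := h ▸ Subgroup.mem_top g
  exact Subgroup.mem_centralizer_singleton_iff.1 hg

theorem commProb_le_five_eighths (G : Type*) [Group G] [Fintype G]
    (h : ¬ ∀ x y : G, x * y = y * x) :
    commProb G ≤ 5 / 8 := by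
  classical
  have hpairs : Nat.card {p : G × G // Commute p.1 p.2}
      = ∑ x : G, Nat.card (Subgroup.centralizer {x}) := by
    rw [← Nat.card_sigma]
    refine Nat.card_congr
      ⟨fun p => ⟨p.1.1, p.1.2, Subgroup.mem_centralizer_singleton_iff.2 p.2.symm.eq⟩,
       fun q => ⟨(q.1, q.2.1), (Subgroup.mem_centralizer_singleton_iff.1 q.2.2).symm⟩,
       fun p => rfl, fun q => rfl⟩
  have hcent : ∀ x : G, x ∉ Subgroup.center G →
      2 * Nat.card (Subgroup.centralizer {x}) ≤ Nat.card G := by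
    intro x hx
    have := two_card_le_of_lt (centralizer_lt_top_of_not_mem hx)
    rwa [Subgroup.card_top] at this
  have hz : 4 * Nat.card (Subgroup.center G) ≤ Nat.card G := by
    push Not at h
    obtain ⟨x, y, hxy⟩ := h
    have hx : x ∉ Subgroup.center G := fun hx =>
      hxy (Subgroup.mem_center_iff.1 hx y).symm
    have hlt : Subgroup.center G < Subgroup.centralizer {x} := by
      refine lt_of_le_of_ne (Subgroup.center_le_centralizer _) fun he => hx ?_
      rw [he]
      exact Subgroup.mem_centralizer_singleton_iff.2 rfl
    have h1 := two_card_le_of_lt hlt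
    have h2 := hcent x hx
    omega
  have hsum : 2 * ∑ x : G, Nat.card (Subgroup.centralizer {x})
      ≤ Nat.card G * Nat.card G + Nat.card (Subgroup.center G) * Nat.card G := by
    calc 2 * ∑ x : G, Nat.card (Subgroup.centralizer {x})
        = ∑ x : G, 2 * Nat.card (Subgroup.centralizer {x}) := Finset.mul_sum _ _ _
      _ ≤ ∑ x : G, (Nat.card G + if x ∈ Subgroup.center G then Nat.card G else 0) := by
        refine Finset.sum_le_sum fun x _ => ?_
        split_ifs with hx
        · have := Subgroup.card_le_card_group (Subgroup.centralizer {x})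
          omega
        · simpa using hcent x hx
      _ = _ := by
        rw [Finset.sum_add_distrib, ← Finset.sum_filter, Finset.sum_const, Finset.sum_const,
          Finset.card_univ, ← Nat.card_eq_fintype_card, smul_eq_mul, smul_eq_mul,
          ← Fintype.card_subtype, ← Nat.card_eq_fintype_card]
  have hfin : 8 * Nat.card {p : G × G // Commute p.1 p.2} ≤ 5 * Nat.card G ^ 2 := by
    rw [hpairs]
    nlinarith [Nat.mul_le_mul_right (Nat.card G) hz]
  have hpos : (0 : ℚ) < (Nat.card G : ℚ) ^ 2 := pow_pos (Nat.cast_pos.2 Nat.card_pos) 2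
  rw [commProb_def, div_le_div_iff₀ hpos (by norm_num)]
  have : (8 : ℚ) * Nat.card {p : G × G // Commute p.1 p.2} ≤ 5 * (Nat.card G : ℚ) ^ 2 := by
    exact_mod_cast hfin
  linarith
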